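/- Let Ω ⊆ ℝ^d be open and connected, let X₁,…,X_m be C^∞ vector fields on the closure of Ω satisfying the Hörmander condition, and let G satisfy conditions (i), (ii) and the ellipticity condition (elli). Then any viscosity subsolution u ∈ USC(Ω) of the subelliptic equation G(x,u,D_X u,(D²_X u)*) = 0 attaining a nonnegative maximum in Ω is constant. -/

import Mathlib

open Set Metric Filter Topology

noncomputable section

/-- Euclidean space `ℝ^d`. -/
abbrev EV (d : ℕ) := EuclideanSpace ℝ (Fin d)

/-- The outer product `p ⊗ p` as a `d × d` matrix. -/
def outer {d : ℕ} (p : EV d) : Matrix (Fin d) (Fin d) ℝ := Matrix.of fun i j => p i * p j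

/-- Euclidean dot product. -/
def dotp {d : ℕ} (p q : EV d) : ℝ := ∑ i, p i * q i

/-- Euclidean gradient. -/
def grad {d : ℕ} (φ : EV d → ℝ) (x : EV d) : EV d :=
  (EuclideanSpace.equiv (Fin d) ℝ).symm fun i => fderiv ℝ φ x (EuclideanSpace.single i 1)

/-- Euclidean Hessian matrix. -/
def hess {d : ℕ} (φ : EV d → ℝ) (x : EV d) : Matrix (Fin d) (Fin d) ℝ :=
  Matrix.of fun i j =>
    fderiv ℝ (fun y => fderiv ℝ φ y (EuclideanSpace.single j 1)) x (EuclideanSpace.single i 1)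

/-- `F` is proper: nondecreasing in `r`, nonincreasing in the matrix argument
(w.r.t. the positive semidefinite order `Y ≤ X ↔ (X - Y).PosSemidef`). -/
def IsProper {d m : ℕ} (Ω : Set (EV d))
    (F : EV d → ℝ → EV m → Matrix (Fin m) (Fin m) ℝ → ℝ) : Prop :=
  ∀ x ∈ Ω, ∀ r s : ℝ, ∀ p : EV m, ∀ X Y : Matrix (Fin m) (Fin m) ℝ,
    r ≤ s → (X - Y).PosSemidef → F x r p X ≤ F x s p Y

/-- Lower semicontinuity of the operator `F`, jointly in all its arguments. -/
def IsLscOperator {d m : ℕ} (Ω : Set (EV d))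
    (F : EV d → ℝ → EV m → Matrix (Fin m) (Fin m) ℝ → ℝ) : Prop :=
  LowerSemicontinuousOn
    (fun q : EV d × ℝ × EV m × Matrix (Fin m) (Fin m) ℝ => F q.1 q.2.1 q.2.2.1 q.2.2.2)
    {q | q.1 ∈ Ω ∧ q.2.2.1 ≠ 0 ∧ q.2.2.2.IsSymm}

/-- Condition (ii) (scaling): for some `φ : (0,1] → (0,∞)`,
`F(x, ξs, ξp, ξX) ≥ φ(ξ) F(x,s,p,X)` for all `ξ ∈ (0,1]`, `s ∈ [-1,0]`. -/
def HasScaling {d m : ℕ} (Ω : Set (EV d))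
    (F : EV d → ℝ → EV m → Matrix (Fin m) (Fin m) ℝ → ℝ) : Prop :=
  ∃ φ : ℝ → ℝ, (∀ ξ ∈ Ioc (0:ℝ) 1, 0 < φ ξ) ∧
    ∀ ξ ∈ Ioc (0:ℝ) 1, ∀ s ∈ Icc (-1:ℝ) 0, ∀ x ∈ Ω, ∀ p : EV m, p ≠ 0 →
      ∀ X : Matrix (Fin m) (Fin m) ℝ, X.IsSymm →
        φ ξ * F x s p X ≤ F x (ξ * s) (ξ • p) (ξ • X)

/-- Ellipticity condition (elli) for a subelliptic operator `G`. -/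
def IsElliptic {d m : ℕ} (Ω : Set (EV d))
    (G : EV d → ℝ → EV m → Matrix (Fin m) (Fin m) ℝ → ℝ) : Prop :=
  ∀ x ∈ Ω, ∀ q : EV m, q ≠ 0 → ∀ X : Matrix (Fin m) (Fin m) ℝ, X.IsSymm →
    ∃ γ : ℝ, 0 < γ ∧ 0 < G x 0 q (X - γ • outer q)

/-- `Z` is a generalized subunit vector for `F` at `x`:
`sup_{γ>0} F(x,0,p, I - γ p⊗p) > 0` whenever `Z·p ≠ 0`. -/
def IsSubunitAt {d : ℕ} (F : EV d → ℝ → EV d → Matrix (Fin d) (Fin d) ℝ → ℝ)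
    (x : EV d) (Z : EV d) : Prop :=
  ∀ p : EV d, dotp Z p ≠ 0 → ∃ γ : ℝ, 0 < γ ∧ 0 < F x 0 p (1 - γ • outer p)

/-- Viscosity subsolution (test functions with nonvanishing gradient). -/
def IsViscSubsol {d : ℕ} (Ω : Set (EV d))
    (F : EV d → ℝ → EV d → Matrix (Fin d) (Fin d) ℝ → ℝ) (u : EV d → ℝ) : Prop :=
  ∀ φ : EV d → ℝ, ContDiff ℝ 2 φ → ∀ x ∈ Ω,
    IsLocalMaxOn (fun y => u y - φ y) Ω x → grad φ x ≠ 0 →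
      F x (u x) (grad φ x) (hess φ x) ≤ 0

/-- Viscosity supersolution (test functions with nonvanishing gradient). -/
def IsViscSupersol {d : ℕ} (Ω : Set (EV d))
    (F : EV d → ℝ → EV d → Matrix (Fin d) (Fin d) ℝ → ℝ) (v : EV d → ℝ) : Prop :=
  ∀ φ : EV d → ℝ, ContDiff ℝ 2 φ → ∀ x ∈ Ω,
    IsLocalMinOn (fun y => v y - φ y) Ω x → grad φ x ≠ 0 →
      0 ≤ F x (v x) (grad φ x) (hess φ x)

/-- Viscosity subsolution (all `C²` test functions). -/
def IsViscSubsolAll {d : ℕ} (Ω : Set (EV d))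
    (F : EV d → ℝ → EV d → Matrix (Fin d) (Fin d) ℝ → ℝ) (u : EV d → ℝ) : Prop :=
  ∀ φ : EV d → ℝ, ContDiff ℝ 2 φ → ∀ x ∈ Ω,
    IsLocalMaxOn (fun y => u y - φ y) Ω x →
      F x (u x) (grad φ x) (hess φ x) ≤ 0

/-- Viscosity supersolution (all `C²` test functions). -/
def IsViscSupersolAll {d : ℕ} (Ω : Set (EV d))
    (F : EV d → ℝ → EV d → Matrix (Fin d) (Fin d) ℝ → ℝ) (v : EV d → ℝ) : Prop :=
  ∀ φ : EV d → ℝ, ContDiff ℝ 2 φ → ∀ x ∈ Ω,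
    IsLocalMinOn (fun y => v y - φ y) Ω x →
      0 ≤ F x (v x) (grad φ x) (hess φ x)

/-- Locally Lipschitz on a set. -/
def LocLipschitzOn {α β : Type*} [PseudoMetricSpace α] [PseudoMetricSpace β]
    (f : α → β) (s : Set α) : Prop :=
  ∀ x ∈ s, ∃ K : NNReal, ∃ ε : ℝ, 0 < ε ∧ LipschitzOnWith K f (s ∩ Metric.ball x ε)

/-- Admissible controls: measurable, with `∑ i βᵢ(t)² ≤ 1`. -/
def Admissible {m : ℕ} (β : ℝ → Fin m → ℝ) : Prop :=
  (∀ i, Measurable fun t => β t i) ∧ ∀ t : ℝ, ∑ i, (β t i) ^ 2 ≤ 1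

/-- (Carathéodory) trajectory of the control system `y' = ∑ᵢ βᵢ Zᵢ(y)` on `[0, T]`. -/
def IsTrajOn {d m : ℕ} (Z : Fin m → EV d → EV d) (β : ℝ → Fin m → ℝ)
    (y : ℝ → EV d) (T : ℝ) : Prop :=
  ContinuousOn y (Icc 0 T) ∧
    ∀ t ∈ Icc 0 T, y t = y 0 + ∫ s in (0:ℝ)..t, ∑ i, β s i • Z i (y s)

/-- `x₁` is reachable from `x₀` by the control system, with trajectory staying in `Ω`. -/
def ReachableIn {d m : ℕ} (Ω : Set (EV d)) (Z : Fin m → EV d → EV d)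
    (x₀ x₁ : EV d) : Prop :=
  ∃ (β : ℝ → Fin m → ℝ) (y : ℝ → EV d) (T : ℝ), 0 ≤ T ∧ Admissible β ∧
    IsTrajOn Z β y T ∧ (∀ t ∈ Icc 0 T, y t ∈ Ω) ∧ y 0 = x₀ ∧ y T = x₁

/-- Bounded time controllability in `Ω`. -/
def BTC {d m : ℕ} (Ω : Set (EV d)) (Z : Fin m → EV d → EV d) : Prop :=
  ∀ x₀ ∈ Ω, ∀ x₁ ∈ Ω, ReachableIn Ω Z x₀ x₁

/-- Generalized exterior (Bony, proximal) normal `ν` to `K` at `z`. -/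
def IsExtNormal {d : ℕ} (K : Set (EV d)) (z ν : EV d) : Prop :=
  z ∈ frontier K ∧ ‖ν‖ = 1 ∧
    ∃ t : ℝ, 0 < t ∧ Metric.closedBall (z + t • ν) t ∩ closure K = {z}

/-- Lie bracket of two vector fields. -/
def vfBracket {d : ℕ} (X Y : EV d → EV d) : EV d → EV d :=
  fun x => fderiv ℝ Y x (X x) - fderiv ℝ X x (Y x)

/-- Vector fields obtained from `Z₁,…,Z_m` by iterated Lie brackets. -/
inductive LieGenerated {d m : ℕ} (Z : Fin m → EV d → EV d) : (EV d → EV d) → Prop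
  | base (i : Fin m) : LieGenerated Z (Z i)
  | bracket {X Y : EV d → EV d} :
      LieGenerated Z X → LieGenerated Z Y → LieGenerated Z (vfBracket X Y)

/-- Hörmander condition: the fields and their iterated brackets span `ℝ^d` at every point of `Ω`. -/
def Hormander {d m : ℕ} (Ω : Set (EV d)) (Z : Fin m → EV d → EV d) : Prop :=
  ∀ x ∈ Ω, Submodule.span ℝ {v : EV d | ∃ W, LieGenerated Z W ∧ W x = v} = ⊤

/-- Intrinsic (horizontal) gradient `σ(x)ᵀ p`. -/
def sigmaT {d m : ℕ} (σ : Fin m → EV d → EV d) (x : EV d) (p : EV d) : EV m :=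
  (EuclideanSpace.equiv (Fin m) ℝ).symm fun j => ∑ i, σ j x i * p i

/-- `σ(x)ᵀ X σ(x)` as an `m × m` matrix. -/
def sigmaHess {d m : ℕ} (σ : Fin m → EV d → EV d) (x : EV d)
    (X : Matrix (Fin d) (Fin d) ℝ) : Matrix (Fin m) (Fin m) ℝ :=
  Matrix.of fun j k => ∑ i, ∑ l, σ j x i * X i l * σ k x l

/-- First-order correction term `g(x,p)` of the symmetrized intrinsic Hessian. -/
def corrTerm {d m : ℕ} (σ : Fin m → EV d → EV d) (x : EV d) (p : EV d) :
    Matrix (Fin m) (Fin m) ℝ :=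
  Matrix.of fun j k =>
    ((∑ i, (fderiv ℝ (σ k) x (σ j x)) i * p i) +
      (∑ i, (fderiv ℝ (σ j) x (σ k x)) i * p i)) / 2

/-- Euclidean form `F(x,r,p,X) = G(x, r, σᵀp, σᵀXσ + g(x,p))` of a subelliptic operator. -/
def euclOp {d m : ℕ} (σ : Fin m → EV d → EV d)
    (G : EV d → ℝ → EV m → Matrix (Fin m) (Fin m) ℝ → ℝ) :
    EV d → ℝ → EV d → Matrix (Fin d) (Fin d) ℝ → ℝ :=
  fun x r p X => G x r (sigmaT σ x p) (sigmaHess σ x X + corrTerm σ x p)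

/-- `A ≥ Z ⊗ Z` in the quadratic-form sense: `ξᵀAξ ≥ (Z·ξ)²` for all `ξ`. -/
def matGEouter {d : ℕ} (A : Matrix (Fin d) (Fin d) ℝ) (Z : EV d) : Prop :=
  ∀ ξ : EV d, (dotp Z ξ) ^ 2 ≤ ∑ i, ∑ j, A i j * ξ i * ξ j

/-- `p` is a proximal (Bony) normal direction to `K` at `z`, formulated locally near `z`. -/
def ProximalNormal {E : Type*} [NormedAddCommGroup E] [InnerProductSpace ℝ E]
    (K : Set E) (z p : E) : Prop :=
  ∃ C r : ℝ, 0 < r ∧ ∀ k ∈ K, dist k z < r → inner ℝ (k - z) p ≤ C * ‖k - z‖ ^ 2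

/-- The vector field `W` is orthogonal to every proximal normal of `K`. -/
def TangentTo {E : Type*} [NormedAddCommGroup E] [InnerProductSpace ℝ E]
    (K : Set E) (W : E → E) : Prop :=
  ∀ z ∈ K, ∀ p, ProximalNormal K z p → inner ℝ (W z) p = 0

section Proximal

variable {E : Type*} [NormedAddCommGroup E] [InnerProductSpace ℝ E]

lemma proximalNormal_of_nearest {K : Set E} {x z k : E} {r : ℝ} (hkr : dist k z < r)
    (hmin : ∀ k' ∈ K ∩ closedBall z r, dist x k ≤ dist x k') : ProximalNormal K k (x - k) := by
  refine ⟨1 / 2, r - dist k z, by linarith, fun k' hk' hd => ?_⟩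
  have h1 : k' ∈ closedBall z r := by
    rw [mem_closedBall]
    linarith [dist_triangle k' k z]
  have h2 := hmin k' ⟨hk', h1⟩
  rw [dist_eq_norm, dist_eq_norm] at h2
  have h3 : ‖x - k'‖ ^ 2 = ‖x - k‖ ^ 2 - 2 * inner ℝ (k' - k) (x - k) + ‖k' - k‖ ^ 2 := by
    rw [show x - k' = (x - k) - (k' - k) by abel, norm_sub_sq_real, real_inner_comm]
  have h4 : ‖x - k‖ ^ 2 ≤ ‖x - k'‖ ^ 2 := by gcongr
  linarith

lemma exists_nearest_proximalNormal {K : Set E} {x z : E} {r : ℝ}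
    (hc : IsCompact (K ∩ closedBall z r)) (hz : z ∈ K) (hx : dist x z < r / 2) :
    ∃ k ∈ K, dist k z < r ∧ infDist x (K ∩ closedBall z r) = dist x k ∧
      ProximalNormal K k (x - k) := by
  have hr : 0 < r := by linarith [dist_nonneg (x := x) (y := z)]
  have hzS : z ∈ K ∩ closedBall z r := ⟨hz, mem_closedBall_self hr.le⟩
  obtain ⟨k, hk, hkd⟩ := hc.exists_infDist_eq_dist ⟨z, hzS⟩ x
  have hmin : ∀ k' ∈ K ∩ closedBall z r, dist x k ≤ dist x k' := fun k' hk' => by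
    rw [← hkd]; exact infDist_le_dist_of_mem hk'
  have hkr : dist k z < r := by
    have := hmin z hzS
    linarith [dist_triangle k x z, dist_comm k x]
  exact ⟨k, hk.1, hkr, hkd, proximalNormal_of_nearest hkr hmin⟩

/-- Grönwall estimate for the squared distance to a set along a curve. -/
lemma infDist_sq_le_gronwallBound {K : Set E} {z : E} {r κ ρ : ℝ}
    (hc : IsCompact (K ∩ closedBall z r)) (hz : z ∈ K) {c c' : ℝ → E}
    (hcd : ∀ θ, HasDerivAt c (c' θ) θ) (hcz : ∀ θ ∈ Icc (0 : ℝ) 1, dist (c θ) z < r / 2)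
    (hest : ∀ θ ∈ Icc (0 : ℝ) 1, ∀ k ∈ K, dist k z < r → ProximalNormal K k (c θ - k) →
      2 * inner ℝ (c' θ) (c θ - k) ≤ κ * ‖c θ - k‖ ^ 2 + ρ) :
    infDist (c 1) (K ∩ closedBall z r) ^ 2 ≤
      gronwallBound (infDist (c 0) (K ∩ closedBall z r) ^ 2) κ ρ 1 := by
  set S := K ∩ closedBall z r with hS
  have hcont : Continuous c := continuous_iff_continuousAt.2 fun θ => (hcd θ).continuousAt
  have key := le_gronwallBound_of_liminf_deriv_right_le (f := fun θ => infDist (c θ) S ^ 2)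
    (f' := fun θ => κ * infDist (c θ) S ^ 2 + ρ) (δ := infDist (c 0) S ^ 2) (K := κ) (ε := ρ)
    (a := 0) (b := 1) (((continuous_infDist_pt S).comp hcont).pow 2).continuousOn ?_ le_rfl
    (fun _ _ => le_rfl) 1 (by simp)
  · simpa using key
  intro θ hθ s hs
  have hθ' : θ ∈ Icc (0 : ℝ) 1 := ⟨hθ.1, hθ.2.le⟩
  obtain ⟨k, hkK, hkr, hkd, hkp⟩ := exists_nearest_proximalNormal hc hz (hcz θ hθ')
  have hkS : k ∈ S := ⟨hkK, mem_closedBall.2 hkr.le⟩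
  have hder : HasDerivAt (fun t => ‖c t - k‖ ^ 2) (2 * inner ℝ (c θ - k) (c' θ)) θ :=
    ((hcd θ).sub_const k).norm_sq
  have hlt : 2 * inner ℝ (c θ - k) (c' θ) < s := by
    have := hest θ hθ' k hkK hkr hkp
    rw [real_inner_comm]
    rw [hkd, dist_eq_norm] at hs
    linarith
  have hslope := (hasDerivAt_iff_tendsto_slope.1 hder).mono_left
    (nhdsWithin_mono θ (fun t (ht : θ < t) => ht.ne'))
  refine Eventually.frequently ?_
  filter_upwards [hslope.eventually (gt_mem_nhds hlt), self_mem_nhdsWithin] with t ht hθt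
  refine lt_of_le_of_lt ?_ ht
  rw [slope_def_field, div_eq_inv_mul]
  have hpos : 0 < t - θ := sub_pos.2 hθt
  have h1 : infDist (c t) S ≤ ‖c t - k‖ := by
    rw [← dist_eq_norm]; exact infDist_le_dist_of_mem hkS
  have h2 : infDist (c θ) S = ‖c θ - k‖ := by rw [hkd, dist_eq_norm]
  have h3 : infDist (c t) S ^ 2 ≤ ‖c t - k‖ ^ 2 := by gcongr; exact infDist_nonneg
  have h4 : infDist (c θ) S ^ 2 = ‖c θ - k‖ ^ 2 := by rw [h2]
  gcongr ?_ * ?_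
  linarith

/-- A short closed loop in the span of two vector fields tangent to `K` ends, up to `o(ε ^ 2)`,
at a point of `K` displaced by a multiple of `ε ^ 2` times their bracket. -/
lemma exists_mem_near_bracket {K : Set E} {z : E} {r : ℝ} (hr : 0 < r)
    (hc : IsCompact (K ∩ closedBall z r)) (hz : z ∈ K) {X Y : E → E} {X' Y' : E →L[ℝ] E}
    (hX : HasFDerivAt X X' z) (hY : HasFDerivAt Y Y' z) {L : NNReal}
    (hLX : LipschitzOnWith L X (ball z r)) (hLY : LipschitzOnWith L Y (ball z r))
    (htX : TangentTo K X) (htY : TangentTo K Y) {η : ℝ} (hη : 0 < η) :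
    ∃ ε₀ > 0, ∀ ε, 0 < ε → ε < ε₀ → ∃ k ∈ K, dist k z ≤ r ∧
      ‖z + (ε ^ 2 / 60) • (Y' (X z) - X' (Y z)) - k‖ ≤ η * ε ^ 2 := by
  let A : ℝ → ℝ := fun θ => θ - θ ^ 2
  let B : ℝ → ℝ := fun θ => θ ^ 2 - θ ^ 3
  let a : ℝ → ℝ := fun θ => 1 - 2 * θ
  let b : ℝ → ℝ := fun θ => 2 * θ - 3 * θ ^ 2
  let Q : ℝ → ℝ := fun θ => 2 / 3 * θ ^ 3 - 5 / 4 * θ ^ 4 + 3 / 5 * θ ^ 5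
  let P : ℝ → ℝ := fun θ => A θ * B θ - Q θ
  have hA : ∀ θ, HasDerivAt A (a θ) θ := fun θ => by
    refine ((hasDerivAt_id' θ).sub (hasDerivAt_pow 2 θ)).congr_deriv ?_
    simp [a]
  have hB : ∀ θ, HasDerivAt B (b θ) θ := fun θ => by
    refine ((hasDerivAt_pow 2 θ).sub (hasDerivAt_pow 3 θ)).congr_deriv ?_
    simp [b]
  have hQ : ∀ θ, HasDerivAt Q (b θ * A θ) θ := fun θ => by
    refine ((((hasDerivAt_pow 3 θ).const_mul (2 / 3)).sub
      ((hasDerivAt_pow 4 θ).const_mul (5 / 4))).add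
      ((hasDerivAt_pow 5 θ).const_mul (3 / 5))).congr_deriv ?_
    simp [b, A]; ring
  have hP : ∀ θ, HasDerivAt P (a θ * B θ) θ := fun θ => by
    refine (((hA θ).mul (hB θ)).sub (hQ θ)).congr_deriv ?_
    ring
  let u : ℝ → E := fun θ => A θ • X z + B θ • Y z
  let V : ℝ → E := fun θ => (A θ ^ 2 / 2) • X' (X z) + P θ • X' (Y z) + Q θ • Y' (X z) +
    (B θ ^ 2 / 2) • Y' (Y z)
  have hu : ∀ θ, HasDerivAt u (a θ • X z + b θ • Y z) θ := fun θ =>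
    ((hA θ).smul_const _).add ((hB θ).smul_const _)
  have hV : ∀ θ, HasDerivAt V (a θ • X' (u θ) + b θ • Y' (u θ)) θ := fun θ => by
    refine ((((((hA θ).pow 2).div_const 2).smul_const (X' (X z))).add
      ((hP θ).smul_const (X' (Y z)))).add ((hQ θ).smul_const (Y' (X z))) |>.add
      ((((hB θ).pow 2).div_const 2).smul_const (Y' (Y z)))).congr_deriv ?_
    simp only [u, map_add, map_smul]
    module
  obtain ⟨C₁, hC₁⟩ := isCompact_Icc.exists_bound_of_continuousOn (s := Icc (0 : ℝ) 1)
    (f := u) (fun θ _ => (hu θ).continuousAt.continuousWithinAt)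
  obtain ⟨C₂, hC₂⟩ := isCompact_Icc.exists_bound_of_continuousOn (s := Icc (0 : ℝ) 1)
    (f := V) (fun θ _ => (hV θ).continuousAt.continuousWithinAt)
  have hC₁0 : 0 ≤ C₁ := (norm_nonneg _).trans (hC₁ 0 (by simp))
  have hC₂0 : 0 ≤ C₂ := (norm_nonneg _).trans (hC₂ 0 (by simp))
  have ha : ∀ θ ∈ Icc (0 : ℝ) 1, |a θ| ≤ 1 := fun θ hθ => by
    rw [abs_le]; constructor <;> simp only [a] <;> linarith [hθ.1, hθ.2]
  have hb : ∀ θ ∈ Icc (0 : ℝ) 1, |b θ| ≤ 1 := fun θ hθ => by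
    rw [abs_le]; constructor <;> simp only [b] <;> nlinarith [hθ.1, hθ.2, sq_nonneg (3 * θ - 1)]
  set κ : ℝ := 4 * L + 1 with hκ
  have hκ1 : 1 ≤ κ := by simp only [hκ]; linarith [L.coe_nonneg]
  set Λ : ℝ := Real.exp κ with hΛ
  have hΛ1 : 1 ≤ Λ := Real.one_le_exp (by linarith)
  set η₁ : ℝ := η / Λ with hη₁
  have hη₁0 : 0 < η₁ := by positivity
  set M : ℝ := C₁ + C₂ + 1 with hM
  set N : ℝ := (‖X'‖ + ‖Y'‖) * C₂ + 1 with hN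
  have hM0 : 0 < M := by positivity
  have hN0 : 0 < N := by positivity
  have hη' : 0 < η₁ / (4 * M) := by positivity
  have hEX := hX.isLittleO.def hη'
  have hEY := hY.isLittleO.def hη'
  obtain ⟨s, hs, hball⟩ := Metric.eventually_nhds_iff.1 (hEX.and hEY)
  refine ⟨min 1 (min (η₁ / (2 * N)) (min (s / M) (r / 2 / M))), by positivity,
    fun ε hε hεlt => ?_⟩
  simp only [lt_min_iff] at hεlt
  obtain ⟨hε1, hε2, hε3, hε4⟩ := hεlt
  rw [lt_div_iff₀ (by positivity)] at hε2 hε3 hε4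
  let c : ℝ → E := fun θ => z + ε • u θ + ε ^ 2 • V θ
  let c' : ℝ → E := fun θ => ε • (a θ • X z + b θ • Y z) +
    ε ^ 2 • (a θ • X' (u θ) + b θ • Y' (u θ))
  have hcd : ∀ θ, HasDerivAt c (c' θ) θ := fun θ =>
    (((hu θ).const_smul ε).const_add z).add ((hV θ).const_smul (ε ^ 2))
  have hcz : ∀ θ ∈ Icc (0 : ℝ) 1, ‖c θ - z‖ ≤ ε * M := fun θ hθ => by
    calc ‖c θ - z‖ = ‖ε • u θ + ε ^ 2 • V θ‖ := by simp only [c]; congr 1; abel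
      _ ≤ ε * C₁ + ε ^ 2 * C₂ := by
        refine (norm_add_le _ _).trans ?_
        rw [norm_smul, norm_smul, Real.norm_of_nonneg hε.le, Real.norm_of_nonneg (sq_nonneg ε)]
        gcongr
        exacts [hC₁ θ hθ, hC₂ θ hθ]
      _ ≤ ε * M := by
        have h1 : ε * (ε * C₂) ≤ 1 * (ε * C₂) := by gcongr
        simp only [hM]; nlinarith
  have hR : ∀ θ ∈ Icc (0 : ℝ) 1,
      ‖c' θ - ε • (a θ • X (c θ) + b θ • Y (c θ))‖ ≤ η₁ * ε ^ 2 := fun θ hθ => by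
    have hd : dist (c θ) z < s := by
      rw [dist_eq_norm]; linarith [hcz θ hθ]
    obtain ⟨h1, h2⟩ := hball hd
    have e1 : c' θ - ε • (a θ • X (c θ) + b θ • Y (c θ)) =
        -(ε • (a θ • (X (c θ) - X z - X' (c θ - z)) + b θ • (Y (c θ) - Y z - Y' (c θ - z))) +
          ε ^ 3 • (a θ • X' (V θ) + b θ • Y' (V θ))) := by
      have : c θ - z = ε • u θ + ε ^ 2 • V θ := by simp only [c]; abel
      rw [this]
      simp only [c', map_add, map_smul]
      module
    rw [e1, norm_neg]
    have h3 : ‖a θ • (X (c θ) - X z - X' (c θ - z)) + b θ • (Y (c θ) - Y z - Y' (c θ - z))‖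
        ≤ 1 * (η₁ / (4 * M) * (ε * M)) + 1 * (η₁ / (4 * M) * (ε * M)) := by
      refine (norm_add_le _ _).trans ?_
      rw [norm_smul, norm_smul]
      gcongr
      · exact ha θ hθ
      · exact h1.trans (by gcongr; exact hcz θ hθ)
      · exact hb θ hθ
      · exact h2.trans (by gcongr; exact hcz θ hθ)
    have h4 : ‖a θ • X' (V θ) + b θ • Y' (V θ)‖ ≤ 1 * (‖X'‖ * C₂) + 1 * (‖Y'‖ * C₂) := by
      refine (norm_add_le _ _).trans ?_
      rw [norm_smul, norm_smul]
      gcongr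
      · exact ha θ hθ
      · exact (X'.le_opNorm _).trans (by gcongr; exact hC₂ θ hθ)
      · exact hb θ hθ
      · exact (Y'.le_opNorm _).trans (by gcongr; exact hC₂ θ hθ)
    have h5 : η₁ / (4 * M) * (ε * M) = η₁ * ε / 4 := by field_simp
    rw [h5] at h3
    refine (norm_add_le _ _).trans ?_
    rw [norm_smul, norm_smul, Real.norm_of_nonneg hε.le, Real.norm_of_nonneg (by positivity)]
    calc _ ≤ ε * (1 * (η₁ * ε / 4) + 1 * (η₁ * ε / 4)) +
          ε ^ 3 * (1 * (‖X'‖ * C₂) + 1 * (‖Y'‖ * C₂)) := by gcongr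
      _ ≤ ε ^ 2 * (η₁ / 2) + ε ^ 2 * (ε * N) := by
        have : 0 < ε ^ 3 := by positivity
        simp only [hN]; nlinarith
      _ ≤ ε ^ 2 * (η₁ / 2) + ε ^ 2 * (η₁ / 2) := by gcongr; linarith
      _ = η₁ * ε ^ 2 := by ring
  have hcb : ∀ θ ∈ Icc (0 : ℝ) 1, dist (c θ) z < r / 2 := fun θ hθ => by
    rw [dist_eq_norm]; linarith [hcz θ hθ]
  have hest : ∀ θ ∈ Icc (0 : ℝ) 1, ∀ k ∈ K, dist k z < r → ProximalNormal K k (c θ - k) →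
      2 * inner ℝ (c' θ) (c θ - k) ≤ κ * ‖c θ - k‖ ^ 2 + (η₁ * ε ^ 2) ^ 2 := by
    intro θ hθ k hk hkr hp
    have hcr : c θ ∈ ball z r := by rw [mem_ball]; linarith [hcb θ hθ]
    have field_est : ∀ W : E → E, LipschitzOnWith L W (ball z r) → TangentTo K W →
        ∀ t : ℝ, |t| ≤ 1 → t * inner ℝ (W (c θ)) (c θ - k) ≤ L * ‖c θ - k‖ ^ 2 := by
      intro W hW htW t ht
      have h1 : inner ℝ (W (c θ)) (c θ - k) = inner ℝ (W (c θ) - W k) (c θ - k) := by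
        rw [inner_sub_left, htW k hk _ hp, sub_zero]
      have h2 : ‖W (c θ) - W k‖ ≤ L * ‖c θ - k‖ := hW.norm_sub_le hcr hkr
      have h3 : |inner ℝ (W (c θ)) (c θ - k)| ≤ L * ‖c θ - k‖ ^ 2 := by
        rw [h1]
        calc _ ≤ ‖W (c θ) - W k‖ * ‖c θ - k‖ := abs_real_inner_le_norm _ _
          _ ≤ L * ‖c θ - k‖ * ‖c θ - k‖ := by gcongr
          _ = _ := by ring
      calc _ ≤ |t * inner ℝ (W (c θ)) (c θ - k)| := le_abs_self _
        _ = |t| * |inner ℝ (W (c θ)) (c θ - k)| := abs_mul _ _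
        _ ≤ 1 * (L * ‖c θ - k‖ ^ 2) := by gcongr
        _ = _ := one_mul _
    have hx := field_est X hLX htX (a θ) (ha θ hθ)
    have hy := field_est Y hLY htY (b θ) (hb θ hθ)
    have h0 : inner ℝ (c' θ - ε • (a θ • X (c θ) + b θ • Y (c θ))) (c θ - k) ≤
        η₁ * ε ^ 2 * ‖c θ - k‖ :=
      (real_inner_le_norm _ _).trans (by gcongr; exact hR θ hθ)
    have h8 : inner ℝ (ε • (a θ • X (c θ) + b θ • Y (c θ))) (c θ - k) =
        ε * (a θ * inner ℝ (X (c θ)) (c θ - k) + b θ * inner ℝ (Y (c θ)) (c θ - k)) := by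
      simp only [inner_smul_left, inner_add_left, conj_trivial]
    rw [inner_sub_left, h8] at h0
    have hLn : 0 ≤ (L : ℝ) * ‖c θ - k‖ ^ 2 := by positivity
    have h6 : ε * (a θ * inner ℝ (X (c θ)) (c θ - k) + b θ * inner ℝ (Y (c θ)) (c θ - k)) ≤
        2 * (L * ‖c θ - k‖ ^ 2) := by
      calc _ ≤ ε * (2 * (L * ‖c θ - k‖ ^ 2)) := by gcongr; linarith
        _ ≤ 1 * (2 * (L * ‖c θ - k‖ ^ 2)) := by gcongr
        _ = _ := one_mul _
    have h7 := sq_nonneg (η₁ * ε ^ 2 - ‖c θ - k‖)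
    simp only [hκ]
    nlinarith
  have hgr := infDist_sq_le_gronwallBound hc hz hcd hcb hest
  have hc0 : c 0 = z := by simp [c, u, V, A, B, P, Q]
  have hzS : z ∈ K ∩ closedBall z r := ⟨hz, mem_closedBall_self hr.le⟩
  have hc1 : c 1 = z + (ε ^ 2 / 60) • (Y' (X z) - X' (Y z)) := by
    simp only [c, u, V, A, B, P, Q]
    module
  rw [hc0, infDist_zero_of_mem hzS, gronwallBound_of_K_ne_0 (by linarith)] at hgr
  obtain ⟨k, hk, hkd⟩ := hc.exists_infDist_eq_dist ⟨z, hzS⟩ (c 1)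
  refine ⟨k, hk.1, mem_closedBall.1 hk.2, ?_⟩
  rw [← hc1, ← dist_eq_norm, ← hkd]
  have hfin : infDist (c 1) (K ∩ closedBall z r) ^ 2 ≤ (η * ε ^ 2) ^ 2 := by
    refine hgr.trans ?_
    have e1 : η = η₁ * Λ := by rw [hη₁]; field_simp
    rw [e1]
    simp only [mul_one, ← hΛ]
    calc _ = (η₁ * ε ^ 2) ^ 2 * ((Λ - 1) / κ) := by ring
      _ ≤ (η₁ * ε ^ 2) ^ 2 * Λ ^ 2 := by
        gcongr
        rw [div_le_iff₀ (by linarith)]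
        nlinarith
      _ = _ := by ring
  exact le_of_sq_le_sq hfin (by positivity)

lemma inner_bracket_nonpos {K : Set E} {z : E} {r : ℝ} (hr : 0 < r)
    (hc : ∀ s ≤ r, IsCompact (K ∩ closedBall z s)) (hz : z ∈ K) {X Y : E → E}
    (hX : ContDiffAt ℝ 1 X z) (hY : ContDiffAt ℝ 1 Y z)
    (htX : TangentTo K X) (htY : TangentTo K Y) {p : E} (hp : ProximalNormal K z p) :
    inner ℝ (fderiv ℝ Y z (X z) - fderiv ℝ X z (Y z)) p ≤ 0 := by
  obtain ⟨L₁, t₁, ht₁, hL₁⟩ := hX.exists_lipschitzOnWith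
  obtain ⟨L₂, t₂, ht₂, hL₂⟩ := hY.exists_lipschitzOnWith
  obtain ⟨C, r₁, hr₁, hC⟩ := hp
  obtain ⟨r₂, hr₂, hsub⟩ := Metric.mem_nhds_iff.1 (inter_mem ht₁ ht₂)
  set s := min r (min (r₁ / 2) r₂) with hs
  have hs0 : 0 < s := by positivity
  have hsr : s ≤ r := min_le_left _ _
  have hs1 : s ≤ r₁ / 2 := (min_le_right _ _).trans (min_le_left _ _)
  have hs2 : s ≤ r₂ := (min_le_right _ _).trans (min_le_right _ _)
  have hb : ball z s ⊆ t₁ ∩ t₂ := (ball_subset_ball hs2).trans hsub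
  have hLX : LipschitzOnWith (max L₁ L₂) X (ball z s) :=
    (hL₁.mono fun x hx => (hb hx).1).weaken (le_max_left _ _)
  have hLY : LipschitzOnWith (max L₁ L₂) Y (ball z s) :=
    (hL₂.mono fun x hx => (hb hx).2).weaken (le_max_right _ _)
  set w := fderiv ℝ Y z (X z) - fderiv ℝ X z (Y z) with hw
  have key : ∀ η > 0, inner ℝ w p / 60 ≤ η * ‖p‖ := by
    intro η hη
    obtain ⟨ε₀, hε₀, hk⟩ := exists_mem_near_bracket hs0 (hc s hsr) hz
      (hX.differentiableAt (by norm_num)).hasFDerivAt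
      (hY.differentiableAt (by norm_num)).hasFDerivAt hLX hLY htX htY hη
    have hlim : Tendsto (fun ε : ℝ => |C| * ε ^ 2 * (‖w‖ / 60 + η) ^ 2 + η * ‖p‖) (𝓝[>] 0)
        (𝓝 (η * ‖p‖)) := by
      have : Continuous fun ε : ℝ => |C| * ε ^ 2 * (‖w‖ / 60 + η) ^ 2 + η * ‖p‖ := by fun_prop
      simpa using (this.tendsto 0).mono_left nhdsWithin_le_nhds
    refine ge_of_tendsto hlim ?_
    filter_upwards [Ioo_mem_nhdsGT hε₀] with ε hε
    obtain ⟨k, hkK, hkz, hkn⟩ := hk ε hε.1 hε.2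
    have hin := hC k hkK (by linarith)
    set e := z + (ε ^ 2 / 60) • w - k with he
    have hkz' : k - z = (ε ^ 2 / 60) • w - e := by simp only [he]; abel
    have hεsq : 0 < ε ^ 2 := by have := hε.1; positivity
    have hn : ‖k - z‖ ≤ ε ^ 2 * (‖w‖ / 60 + η) := by
      rw [hkz']
      refine (norm_sub_le _ _).trans ?_
      rw [norm_smul, Real.norm_of_nonneg (by positivity)]
      linarith
    have hn2 : ‖k - z‖ ^ 2 ≤ (ε ^ 2 * (‖w‖ / 60 + η)) ^ 2 := by gcongr
    have he' : inner ℝ e p ≤ η * ε ^ 2 * ‖p‖ :=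
      (real_inner_le_norm _ _).trans (by gcongr)
    have hmain : ε ^ 2 * (inner ℝ w p / 60) ≤
        ε ^ 2 * (|C| * ε ^ 2 * (‖w‖ / 60 + η) ^ 2 + η * ‖p‖) := by
      have h1 : inner ℝ (k - z) p = ε ^ 2 / 60 * inner ℝ w p - inner ℝ e p := by
        rw [hkz', inner_sub_left, inner_smul_left]; simp
      have h2 : C * ‖k - z‖ ^ 2 ≤ |C| * (ε ^ 2 * (‖w‖ / 60 + η)) ^ 2 := by
        gcongr; exact le_abs_self C
      nlinarith
    exact le_of_mul_le_mul_left hmain hεsq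
  have hlim : Tendsto (fun η : ℝ => η * ‖p‖) (𝓝[>] 0) (𝓝 0) := by
    have : Continuous fun η : ℝ => η * ‖p‖ := by fun_prop
    simpa using (this.tendsto 0).mono_left nhdsWithin_le_nhds
  have := ge_of_tendsto hlim (eventually_mem_nhdsWithin.mono fun η hη => key η hη)
  linarith

end Proximal

section Operator

variable {d m : ℕ}

lemma sigmaT_apply (σ : Fin m → EV d → EV d) (x p : EV d) (j : Fin m) :
    sigmaT σ x p j = inner ℝ (σ j x) p := by
  simp [sigmaT, PiLp.inner_apply, mul_comm]

lemma sigmaT_smul (σ : Fin m → EV d → EV d) (x p : EV d) (t : ℝ) :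
    sigmaT σ x (t • p) = t • sigmaT σ x p := by
  ext j
  simp [sigmaT_apply, inner_smul_right]

lemma sigmaHess_smul (σ : Fin m → EV d → EV d) (x : EV d) (X : Matrix (Fin d) (Fin d) ℝ) (t : ℝ) :
    sigmaHess σ x (t • X) = t • sigmaHess σ x X := by
  ext j k
  simp only [sigmaHess, Matrix.of_apply, Matrix.smul_apply, smul_eq_mul, Finset.mul_sum]
  exact Finset.sum_congr rfl fun i _ => Finset.sum_congr rfl fun l _ => by ring

lemma sigmaHess_sub (σ : Fin m → EV d → EV d) (x : EV d) (X Y : Matrix (Fin d) (Fin d) ℝ) :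
    sigmaHess σ x (X - Y) = sigmaHess σ x X - sigmaHess σ x Y := by
  ext j k
  simp only [sigmaHess, Matrix.of_apply, Matrix.sub_apply, mul_sub, sub_mul,
    Finset.sum_sub_distrib]

lemma sigmaHess_outer (σ : Fin m → EV d → EV d) (x p : EV d) :
    sigmaHess σ x (outer p) = outer (sigmaT σ x p) := by
  ext j k
  simp only [sigmaHess, outer, sigmaT, Matrix.of_apply]
  change _ = (∑ i, σ j x i * p i) * ∑ i, σ k x i * p i
  rw [Finset.sum_mul_sum]
  exact Finset.sum_congr rfl fun i _ => Finset.sum_congr rfl fun l _ => by ring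

lemma corrTerm_smul (σ : Fin m → EV d → EV d) (x p : EV d) (t : ℝ) :
    corrTerm σ x (t • p) = t • corrTerm σ x p := by
  ext j k
  simp only [corrTerm, Matrix.of_apply, Matrix.smul_apply, smul_eq_mul, PiLp.smul_apply]
  rw [mul_div_assoc', mul_add, Finset.mul_sum, Finset.mul_sum]
  congr 2 <;> exact Finset.sum_congr rfl fun i _ => by ring

lemma outer_neg (p : EV d) : outer (-p) = outer p := by
  ext i j
  simp [outer]

lemma isSymm_sigmaHess (σ : Fin m → EV d → EV d) (x : EV d) {X : Matrix (Fin d) (Fin d) ℝ}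
    (hX : X.IsSymm) : (sigmaHess σ x X).IsSymm := by
  refine Matrix.IsSymm.ext fun j k => ?_
  simp only [sigmaHess, Matrix.of_apply]
  rw [Finset.sum_comm]
  refine Finset.sum_congr rfl fun i _ => Finset.sum_congr rfl fun l _ => ?_
  rw [hX.apply]; ring

lemma isSymm_corrTerm (σ : Fin m → EV d → EV d) (x p : EV d) : (corrTerm σ x p).IsSymm := by
  refine Matrix.IsSymm.ext fun j k => ?_
  simp only [corrTerm, Matrix.of_apply]
  rw [add_comm]

lemma grad_apply (φ : EV d → ℝ) (x : EV d) (i : Fin d) :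
    grad φ x i = fderiv ℝ φ x (EuclideanSpace.single i 1) := rfl

lemma grad_const_mul {φ : EV d → ℝ} (hφ : ContDiff ℝ 2 φ) (t : ℝ) (x : EV d) :
    grad (fun y => t * φ y) x = t • grad φ x := by
  ext i
  rw [grad_apply, fderiv_const_mul (hφ.differentiable (by norm_num) x)]
  simp [grad_apply]

lemma contDiff_fderiv_apply {φ : EV d → ℝ} (hφ : ContDiff ℝ 2 φ) (v : EV d) :
    ContDiff ℝ 1 fun y => fderiv ℝ φ y v :=
  (hφ.fderiv_right (m := 1) (by norm_num)).clm_apply contDiff_const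

lemma hess_const_mul {φ : EV d → ℝ} (hφ : ContDiff ℝ 2 φ) (t : ℝ) (x : EV d) :
    hess (fun y => t * φ y) x = t • hess φ x := by
  ext i j
  simp only [hess, Matrix.of_apply, Matrix.smul_apply, smul_eq_mul]
  have h1 : (fun y => fderiv ℝ (fun y => t * φ y) y (EuclideanSpace.single j 1)) =
      fun y => t * fderiv ℝ φ y (EuclideanSpace.single j 1) := by
    funext y
    rw [fderiv_const_mul (hφ.differentiable (by norm_num) y)]
    simp
  rw [h1, fderiv_const_mul ((contDiff_fderiv_apply hφ _).differentiable (by norm_num) x)]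
  simp

lemma isSymm_hess {φ : EV d → ℝ} (hφ : ContDiff ℝ 2 φ) (x : EV d) : (hess φ x).IsSymm := by
  refine Matrix.IsSymm.ext fun i j => ?_
  have hd : DifferentiableAt ℝ (fderiv ℝ φ) x :=
    (hφ.fderiv_right (m := 1) (by norm_num)).differentiable (by norm_num) x
  have hs : IsSymmSndFDerivAt ℝ φ x := hφ.contDiffAt.isSymmSndFDerivAt (by simp)
  simp only [hess, Matrix.of_apply]
  rw [fderiv_clm_apply hd (differentiableAt_const _), fderiv_clm_apply hd (differentiableAt_const _)]
  simpa using hs _ _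

lemma continuous_grad {φ : EV d → ℝ} (hφ : ContDiff ℝ 2 φ) : Continuous (grad φ) :=
  (EuclideanSpace.equiv (Fin d) ℝ).symm.continuous.comp
    (continuous_pi fun _ => (contDiff_fderiv_apply hφ _).continuous)

lemma continuous_hess_apply {φ : EV d → ℝ} (hφ : ContDiff ℝ 2 φ) (i j : Fin d) :
    Continuous fun x => hess φ x i j :=
  ((contDiff_fderiv_apply hφ _).continuous_fderiv (by norm_num)).clm_apply continuous_const

lemma continuous_coord (i : Fin d) : Continuous fun p : EV d => p i :=
  (continuous_apply i).comp (EuclideanSpace.equiv (Fin d) ℝ).continuous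

lemma continuousAt_sigmaT {σ : Fin m → EV d → EV d} {z : EV d}
    (hσ : ∀ j, ContinuousAt (σ j) z) {P : EV d → EV d} (hP : ContinuousAt P z) :
    ContinuousAt (fun x => sigmaT σ x (P x)) z := by
  refine (EuclideanSpace.equiv (Fin m) ℝ).symm.continuous.continuousAt.comp
    (continuousAt_pi.2 fun j => ?_)
  exact tendsto_finsetSum _ fun i _ =>
    ((continuous_coord i).continuousAt.comp (hσ j)).mul ((continuous_coord i).continuousAt.comp hP)

lemma continuousAt_sigmaHess {σ : Fin m → EV d → EV d} {z : EV d}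
    (hσ : ∀ j, ContinuousAt (σ j) z) {A : EV d → Matrix (Fin d) (Fin d) ℝ}
    (hA : ∀ i l, ContinuousAt (fun x => A x i l) z) :
    ContinuousAt (fun x => sigmaHess σ x (A x)) z := by
  refine continuousAt_pi.2 fun j => continuousAt_pi.2 fun k => ?_
  change ContinuousAt (fun x => ∑ i, ∑ l, σ j x i * A x i l * σ k x l) z
  exact tendsto_finsetSum _ fun i _ => tendsto_finsetSum _ fun l _ =>
    (((continuous_coord i).continuousAt.comp (hσ j)).mul (hA i l)).mul
      ((continuous_coord l).continuousAt.comp (hσ k))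

lemma continuousAt_corrTerm {σ : Fin m → EV d → EV d} {z : EV d}
    (hσ : ∀ j, ContDiffAt ℝ 1 (σ j) z) {P : EV d → EV d} (hP : ContinuousAt P z) :
    ContinuousAt (fun x => corrTerm σ x (P x)) z := by
  have hterm : ∀ j k : Fin m,
      ContinuousAt (fun x => ∑ i, (fderiv ℝ (σ k) x (σ j x)) i * P x i) z := fun j k =>
    tendsto_finsetSum _ fun i _ =>
      ((continuous_coord i).continuousAt.comp
        (((hσ k).continuousAt_fderiv (by norm_num)).clm_apply (hσ j).continuousAt)).mul
        ((continuous_coord i).continuousAt.comp hP)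
  refine continuousAt_pi.2 fun j => continuousAt_pi.2 fun k => ?_
  exact ((hterm j k).add (hterm k j)).div_const 2

end Operator

section MaximumPrinciple

variable {d m : ℕ} {Ω : Set (EV d)} {σ : Fin m → EV d → EV d}
  {G : EV d → ℝ → EV m → Matrix (Fin m) (Fin m) ℝ → ℝ} {u : EV d → ℝ} {M : ℝ}

/-- No smooth strict supersolution can touch the level `M` of a subsolution bounded by `M` at a
point `z` of the contact set while being positive at the nearby contact points. -/
lemma false_of_strict_test (hΩ : IsOpen Ω) (hσ : ∀ j, ContDiffOn ℝ 1 (σ j) Ω)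
    (hGlsc : IsLscOperator (closure Ω) G) (hGprop : IsProper (closure Ω) G)
    (hGscal : HasScaling (closure Ω) G) (husc : UpperSemicontinuousOn u Ω)
    (hsub : IsViscSubsol Ω (euclOp σ G) u) (hmax : ∀ x ∈ Ω, u x ≤ M) (hM : 0 ≤ M)
    {z : EV d} (hz : z ∈ Ω) (huz : u z = M) {ψ : EV d → ℝ} (hψ : ContDiff ℝ 2 ψ)
    (hψz : ψ z = 0) (hq : sigmaT σ z (grad ψ z) ≠ 0)
    (hpos : 0 < euclOp σ G z 0 (grad ψ z) (hess ψ z))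
    (hcontact : ∀ᶠ x in 𝓝 z, u x = M → x ≠ z → 0 < ψ x) : False := by
  have hσz : ∀ j, ContDiffAt ℝ 1 (σ j) z := fun j => (hσ j).contDiffAt (hΩ.mem_nhds hz)
  have hcg : ContinuousAt (grad ψ) z := (continuous_grad hψ).continuousAt
  have hcT := continuousAt_sigmaT (fun j => (hσz j).continuousAt) hcg
  let Hm : EV d → Matrix (Fin m) (Fin m) ℝ := fun x =>
    sigmaHess σ x (hess ψ x) + corrTerm σ x (grad ψ x)
  have hcH : ContinuousAt Hm z :=
    (continuousAt_sigmaHess (fun j => (hσz j).continuousAt)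
      (fun i l => (continuous_hess_apply hψ i l).continuousAt)).add (continuousAt_corrTerm hσz hcg)
  have hsymm : ∀ x, (Hm x).IsSymm := fun x =>
    (isSymm_sigmaHess σ x (isSymm_hess hψ x)).add (isSymm_corrTerm σ x _)
  let Φ : EV d → EV d × ℝ × EV m × Matrix (Fin m) (Fin m) ℝ := fun x =>
    (x, ψ x, sigmaT σ x (grad ψ x), Hm x)
  have hcΦ : ContinuousAt Φ z :=
    continuousAt_id.prodMk (hψ.continuous.continuousAt.prodMk (hcT.prodMk hcH))
  have hnear : ∀ᶠ x in 𝓝 z, x ∈ Ω ∧ sigmaT σ x (grad ψ x) ≠ 0 ∧ -1 < ψ x ∧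
      0 < G x (ψ x) (sigmaT σ x (grad ψ x)) (Hm x) ∧ (u x = M → x ≠ z → 0 < ψ x) := by
    have h1 : ∀ᶠ x in 𝓝 z, x ∈ Ω := hΩ.mem_nhds hz
    have h2 : ∀ᶠ x in 𝓝 z, sigmaT σ x (grad ψ x) ≠ 0 := hcT.eventually_ne hq
    have h3 : ∀ᶠ x in 𝓝 z, -1 < ψ x :=
      hψ.continuous.continuousAt.eventually (lt_mem_nhds (by rw [hψz]; norm_num))
    have h4 := hGlsc (Φ z) ⟨subset_closure hz, hq, hsymm z⟩ 0 (by
      simp only [Φ, hψz]; exact hpos)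
    have h5 := hcΦ.eventually (eventually_nhdsWithin_iff.1 h4)
    filter_upwards [h1, h2, h3, h5, hcontact] with x hx1 hx2 hx3 hx5 hx6
    exact ⟨hx1, hx2, hx3, hx5 ⟨subset_closure hx1, hx2, hsymm x⟩, hx6⟩
  obtain ⟨r, hr, hball⟩ := Metric.nhds_basis_closedBall.eventually_iff.1 hnear
  have hsubΩ : closedBall z r ⊆ Ω := fun x hx => (hball hx).1
  have hcomp : IsCompact (closedBall z r) := isCompact_closedBall z r
  obtain ⟨B, hB⟩ := hcomp.exists_bound_of_continuousOn hψ.continuous.continuousOn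
  have hB0 : 0 ≤ B := (norm_nonneg _).trans (hB z (mem_closedBall_self hr.le))
  obtain ⟨δ, hδ, hδT⟩ : ∃ δ > 0, ∀ x ∈ sphere z r ∩ {x | ψ x ≤ 0}, u x ≤ M - δ := by
    rcases (sphere z r ∩ {x | ψ x ≤ 0}).eq_empty_or_nonempty with he | hne
    · exact ⟨1, one_pos, fun x hx => by rw [he] at hx; exact absurd hx (notMem_empty x)⟩
    · have hTc : IsCompact (sphere z r ∩ {x | ψ x ≤ 0}) :=
        (isCompact_sphere z r).inter_right (isClosed_le hψ.continuous continuous_const)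
      have hTΩ : sphere z r ∩ {x | ψ x ≤ 0} ⊆ Ω := fun x hx =>
        hsubΩ (sphere_subset_closedBall hx.1)
      obtain ⟨y, hy, hymax⟩ := (husc.mono hTΩ).exists_isMaxOn hne hTc
      have hyM : u y < M := by
        refine lt_of_le_of_ne (hmax y (hTΩ hy)) fun hyM => ?_
        have hyz : y ≠ z := by
          rintro rfl
          have := mem_sphere.1 hy.1
          rw [dist_self] at this
          linarith
        have h1 := (hball (sphere_subset_closedBall hy.1)).2.2.2.2 hyM hyz
        have h2 : ψ y ≤ 0 := hy.2
        linarith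
      exact ⟨M - u y, by linarith, fun x hx => by have : u x ≤ u y := hymax hx; linarith⟩
  set ε : ℝ := min 1 (δ / (2 * (B + 1))) with hε
  have hε0 : 0 < ε := by positivity
  have hε1 : ε ≤ 1 := min_le_left _ _
  have hεB : ε * B < δ := by
    have h1 : ε ≤ δ / (2 * (B + 1)) := min_le_right _ _
    rw [le_div_iff₀ (by positivity)] at h1
    nlinarith
  have huscw : UpperSemicontinuousOn (fun x => u x + -(ε * ψ x)) (closedBall z r) :=
    (husc.mono hsubΩ).add
      ((hψ.continuous.const_mul ε).neg.upperSemicontinuous.upperSemicontinuousOn _)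
  obtain ⟨y, hy, hymax⟩ := huscw.exists_isMaxOn ⟨z, mem_closedBall_self hr.le⟩ hcomp
  have hyM : M ≤ u y + -(ε * ψ y) := by
    have : u z + -(ε * ψ z) ≤ u y + -(ε * ψ y) := hymax (mem_closedBall_self hr.le)
    rw [huz, hψz] at this
    linarith
  obtain ⟨hyΩ, hyq, hyψ, hyG, -⟩ := hball hy
  have hψy : ψ y ≤ 0 := by
    by_contra! h
    have := mul_pos hε0 h
    linarith [hmax y hyΩ]
  have hyball : y ∈ ball z r := by
    rcases (mem_closedBall.1 hy).lt_or_eq with h | h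
    · exact h
    · have h1 := hδT y ⟨mem_sphere.2 h, hψy⟩
      have h2 : -ψ y ≤ B := (neg_le_abs _).trans (hB y hy)
      have h3 : ε * (-ψ y) ≤ ε * B := by gcongr
      linarith
  have hloc : IsLocalMaxOn (fun x => u x - ε * ψ x) Ω y := by
    refine Filter.Eventually.filter_mono nhdsWithin_le_nhds ?_
    filter_upwards [isOpen_ball.mem_nhds hyball] with x hx
    have : u x + -(ε * ψ x) ≤ u y + -(ε * ψ y) := hymax (ball_subset_closedBall hx)
    linarith
  have hgrad : grad ψ y ≠ 0 := by
    intro h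
    apply hyq
    rw [h, ← zero_smul ℝ (0 : EV d), sigmaT_smul, zero_smul]
  have hvisc := hsub (fun x => ε * ψ x) (contDiff_const.mul hψ) y hyΩ hloc (by
    rw [grad_const_mul hψ]; exact smul_ne_zero hε0.ne' hgrad)
  rw [grad_const_mul hψ, hess_const_mul hψ] at hvisc
  simp only [euclOp, sigmaT_smul, sigmaHess_smul, corrTerm_smul, ← smul_add] at hvisc
  have hmono := hGprop y (subset_closure hyΩ) (ε * ψ y) (u y) (ε • sigmaT σ y (grad ψ y))
    (ε • Hm y) (ε • Hm y) (by linarith) (by rw [sub_self]; exact Matrix.PosSemidef.zero)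
  obtain ⟨f, hf, hscale⟩ := hGscal
  have h1 := hscale ε ⟨hε0, hε1⟩ (ψ y) ⟨hyψ.le, hψy⟩ y (subset_closure hyΩ) _ hyq (Hm y) (hsymm y)
  have h2 := mul_pos (hf ε ⟨hε0, hε1⟩) hyG
  simp only [Hm] at hmono h1 h2
  linarith

/-- Quadratic function vanishing at `z`, used to build barriers in the normal direction `p`. -/
def normalBarrier (C : ℝ) (z p : EV d) (x : EV d) : ℝ := C * ‖x - z‖ ^ 2 - inner ℝ p (x - z)

lemma hasFDerivAt_normalBarrier (C : ℝ) (z p x : EV d) :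
    HasFDerivAt (normalBarrier C z p) ((2 * C) • innerSL ℝ (x - z) - innerSL ℝ p) x := by
  have h0 : HasFDerivAt (fun y : EV d => y - z) (ContinuousLinearMap.id ℝ (EV d)) x :=
    (hasFDerivAt_id x).sub_const z
  have h1 := (h0.norm_sq.const_mul C).sub ((innerSL ℝ p).hasFDerivAt.comp x h0)
  refine h1.congr_fderiv ?_
  ext v
  simp
  ring

lemma contDiff_normalBarrier (C : ℝ) (z p : EV d) {n : WithTop ℕ∞} :
    ContDiff ℝ n (normalBarrier C z p) :=
  (contDiff_const.mul ((contDiff_id.sub contDiff_const).norm_sq ℝ)).sub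
    (contDiff_const.inner ℝ (contDiff_id.sub contDiff_const))

lemma normalBarrier_self (C : ℝ) (z p : EV d) : normalBarrier C z p z = 0 := by
  simp [normalBarrier]

lemma fderiv_barrier (C γ : ℝ) (z p x : EV d) :
    fderiv ℝ (fun y => normalBarrier C z p y - γ * normalBarrier C z p y ^ 2) x =
      (1 - 2 * γ * normalBarrier C z p x) • ((2 * C) • innerSL ℝ (x - z) - innerSL ℝ p) := by
  have h := hasFDerivAt_normalBarrier C z p x
  refine ((h.sub ((h.pow 2).const_mul γ)).congr_fderiv ?_).fderiv
  ext v
  simp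
  ring

lemma grad_barrier (C γ : ℝ) (z p : EV d) :
    grad (fun y => normalBarrier C z p y - γ * normalBarrier C z p y ^ 2) z = -p := by
  ext i
  rw [grad_apply, fderiv_barrier, normalBarrier_self]
  simp [EuclideanSpace.inner_single_right]

lemma hess_barrier (C γ : ℝ) (z p : EV d) :
    hess (fun y => normalBarrier C z p y - γ * normalBarrier C z p y ^ 2) z =
      (2 * C) • (1 : Matrix (Fin d) (Fin d) ℝ) - (2 * γ) • outer p := by
  ext i j
  simp only [hess, Matrix.of_apply, fderiv_barrier]
  set e : EV d := EuclideanSpace.single j 1 with he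
  have h0 : HasFDerivAt (fun y : EV d => y - z) (ContinuousLinearMap.id ℝ (EV d)) z :=
    (hasFDerivAt_id z).sub_const z
  have h1 : HasFDerivAt (fun y => 1 - 2 * γ * normalBarrier C z p y) _ z :=
    ((hasFDerivAt_normalBarrier C z p z).const_mul (2 * γ)).const_sub 1
  have h2 : HasFDerivAt (fun y : EV d => 2 * C * inner ℝ e (y - z) - inner ℝ p e) _ z :=
    (((innerSL ℝ e).hasFDerivAt.comp z h0).const_mul (2 * C)).sub_const _
  have h3 : (fun y => ((1 - 2 * γ * normalBarrier C z p y) •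
      ((2 * C) • innerSL ℝ (y - z) - innerSL ℝ p)) e) =
      fun y => (1 - 2 * γ * normalBarrier C z p y) *
        (2 * C * inner ℝ e (y - z) - inner ℝ p e) := by
    funext y
    rw [real_inner_comm]
    rfl
  have h4 : fderiv ℝ (fun y => (1 - 2 * γ * normalBarrier C z p y) *
      (2 * C * inner ℝ e (y - z) - inner ℝ p e)) z = _ := (h1.mul h2).fderiv
  rw [h3, h4]
  simp only [he, normalBarrier_self, outer, EuclideanSpace.inner_single_right]
  by_cases hij : i = j
  · subst hij
    simp [EuclideanSpace.inner_single_right]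
    ring
  · simp [EuclideanSpace.inner_single_right, hij]
    ring

/-- The vector fields are tangent to the set where a subsolution attains its nonnegative
maximum. -/
lemma tangentTo_contactSet (hΩ : IsOpen Ω) (hσ : ∀ j, ContDiffOn ℝ 1 (σ j) Ω)
    (hGlsc : IsLscOperator (closure Ω) G) (hGprop : IsProper (closure Ω) G)
    (hGscal : HasScaling (closure Ω) G) (hGell : IsElliptic Ω G)
    (husc : UpperSemicontinuousOn u Ω)
    (hsub : IsViscSubsol Ω (euclOp σ G) u) (hmax : ∀ x ∈ Ω, u x ≤ M) (hM : 0 ≤ M) (j : Fin m) :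
    TangentTo {x ∈ Ω | u x = M} (σ j) := by
  rintro z ⟨hz, huz⟩ p ⟨C, r, hr, hC⟩
  by_contra hne
  set q := sigmaT σ z (-p) with hqdef
  have hq : q ≠ 0 := by
    intro h
    apply hne
    have h1 : q j = 0 := by rw [h]; rfl
    rw [hqdef, sigmaT_apply, inner_neg_right] at h1
    linarith
  set C₁ := |C| + 1 with hC₁
  set X : Matrix (Fin m) (Fin m) ℝ :=
    sigmaHess σ z ((2 * C₁) • (1 : Matrix (Fin d) (Fin d) ℝ)) + corrTerm σ z (-p) with hX
  have hXs : X.IsSymm :=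
    (isSymm_sigmaHess σ z (Matrix.isSymm_one.smul _)).add (isSymm_corrTerm σ z _)
  obtain ⟨γ, hγ, hpos⟩ := hGell z hz q hq X hXs
  have hsmooth := contDiff_normalBarrier (n := 2) C₁ z p
  refine false_of_strict_test hΩ hσ hGlsc hGprop hGscal husc hsub hmax hM hz huz
    (ψ := fun y => normalBarrier C₁ z p y - γ / 2 * normalBarrier C₁ z p y ^ 2)
    (hsmooth.sub (contDiff_const.mul (hsmooth.pow 2))) (by simp [normalBarrier_self])
    (by rwa [grad_barrier]) ?_ ?_
  · rw [grad_barrier, hess_barrier]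
    simp only [euclOp, sigmaHess_sub, sigmaHess_smul _ _ (outer p)]
    rw [← outer_neg p, sigmaHess_outer, mul_div_cancel₀ γ two_ne_zero, sub_add_eq_add_sub]
    exact hpos
  · have hsmall : ∀ᶠ x in 𝓝 z, γ / 2 * normalBarrier C₁ z p x < 1 :=
      (hsmooth.continuous.const_mul (γ / 2)).continuousAt.eventually
        (gt_mem_nhds (by simp [normalBarrier_self]))
    filter_upwards [hsmall, ball_mem_nhds z hr, hΩ.mem_nhds hz] with x hx hxr hxΩ hux hxz
    have h1 := hC x ⟨hxΩ, hux⟩ hxr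
    have h2 : 0 < ‖x - z‖ := norm_pos_iff.2 (sub_ne_zero.2 hxz)
    have h3 : 0 < normalBarrier C₁ z p x := by
      rw [normalBarrier, real_inner_comm]
      have : C ≤ |C| := le_abs_self C
      have h4 : 0 < ‖x - z‖ ^ 2 := by positivity
      simp only [hC₁]
      nlinarith
    nlinarith

lemma LieGenerated.contDiffOn (hΩ : IsOpen Ω) (hσ : ∀ j, ContDiffOn ℝ (⊤ : ℕ∞) (σ j) Ω)
    {W : EV d → EV d} (hW : LieGenerated σ W) : ContDiffOn ℝ (⊤ : ℕ∞) W Ω := by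
  induction hW with
  | base i => exact hσ i
  | bracket _ _ hX hY =>
    exact ((hY.fderiv_of_isOpen hΩ (by simp)).clm_apply hX).sub
      ((hX.fderiv_of_isOpen hΩ (by simp)).clm_apply hY)

lemma exists_isCompact_inter_closedBall (hΩ : IsOpen Ω) {K F : Set (EV d)} (hF : IsClosed F)
    (hKF : K = Ω ∩ F) {z : EV d} (hz : z ∈ K) :
    ∃ r > 0, ∀ s ≤ r, IsCompact (K ∩ closedBall z s) := by
  obtain ⟨r, hr, hsub⟩ :=
    Metric.nhds_basis_closedBall.mem_iff.1 (hΩ.mem_nhds (hKF ▸ hz : z ∈ Ω ∩ F).1)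
  refine ⟨r, hr, fun s hs => ?_⟩
  have : K ∩ closedBall z s = closedBall z s ∩ F := by
    rw [hKF]
    ext x
    exact ⟨fun h => ⟨h.2, h.1.2⟩, fun h => ⟨⟨hsub (closedBall_subset_closedBall hs h.1), h.2⟩, h.1⟩⟩
  rw [this]
  exact (isCompact_closedBall z s).inter_right hF

lemma LieGenerated.tangentTo (hΩ : IsOpen Ω) (hσ : ∀ j, ContDiffOn ℝ (⊤ : ℕ∞) (σ j) Ω)
    {K F : Set (EV d)} (hF : IsClosed F) (hKF : K = Ω ∩ F) (ht : ∀ j, TangentTo K (σ j))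
    {W : EV d → EV d} (hW : LieGenerated σ W) : TangentTo K W := by
  induction hW with
  | base i => exact ht i
  | @bracket X Y hX hY htX htY =>
    intro z hz p hp
    have hzΩ : z ∈ Ω := (hKF ▸ hz : z ∈ Ω ∩ F).1
    have hsm : ∀ {W : EV d → EV d}, LieGenerated σ W → ContDiffAt ℝ 1 W z := fun h =>
      ((h.contDiffOn hΩ hσ).contDiffAt (hΩ.mem_nhds hzΩ)).of_le (by exact_mod_cast le_top)
    obtain ⟨r, hr, hc⟩ := exists_isCompact_inter_closedBall hΩ hF hKF hz
    have h1 := inner_bracket_nonpos hr hc hz (hsm hX) (hsm hY) htX htY hp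
    have h2 := inner_bracket_nonpos hr hc hz (hsm hY) (hsm hX) htY htX hp
    rw [← neg_sub, inner_neg_left] at h2
    exact le_antisymm h1 (neg_nonpos.1 h2)

/-- A relatively closed set all of whose proximal normals vanish is relatively open. -/
lemma mem_nhds_of_proximalNormal_eq_zero (hΩ : IsOpen Ω) {K F : Set (EV d)} (hF : IsClosed F)
    (hKF : K = Ω ∩ F) (hn : ∀ z ∈ K, ∀ p, ProximalNormal K z p → p = 0) {z : EV d}
    (hz : z ∈ K) : K ∈ 𝓝 z := by
  obtain ⟨r, hr, hc⟩ := exists_isCompact_inter_closedBall hΩ hF hKF hz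
  filter_upwards [ball_mem_nhds z (half_pos hr)] with x hx
  obtain ⟨k, hk, -, -, hp⟩ := exists_nearest_proximalNormal (hc r le_rfl) hz hx
  rwa [sub_eq_zero.1 (hn k hk _ hp)]

end MaximumPrinciple

/-- Corollary 1.4, SMP for fully nonlinear subelliptic equations:
for an elliptic operator `G` over smooth Hörmander vector fields `X₁,…,X_m`, any viscosity
subsolution of `G(x,u,D_X u,(D²_X u)*) = 0` attaining a nonnegative maximum in `Ω` is constant. -/
theorem strong_maximum_principle_subelliptic {d m : ℕ} (Ω : Set (EV d))
    (hΩ : IsOpen Ω) (hconn : IsConnected Ω)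
    (σ : Fin m → EV d → EV d)
    (hσsmooth : ∀ j, ContDiffOn ℝ (⊤ : ℕ∞) (σ j) (closure Ω))
    (hhor : Hormander Ω σ)
    (G : EV d → ℝ → EV m → Matrix (Fin m) (Fin m) ℝ → ℝ)
    (hGlsc : IsLscOperator (closure Ω) G) (hGprop : IsProper (closure Ω) G)
    (hGscal : HasScaling (closure Ω) G) (hGell : IsElliptic Ω G)
    (u : EV d → ℝ) (husc : UpperSemicontinuousOn u Ω)
    (hsub : IsViscSubsol Ω (euclOp σ G) u)
    (x₀ : EV d) (hx₀ : x₀ ∈ Ω) (hmax : ∀ x ∈ Ω, u x ≤ u x₀) (hnn : 0 ≤ u x₀) :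
    ∀ x ∈ Ω, u x = u x₀ := by
  have hσΩ : ∀ j, ContDiffOn ℝ (⊤ : ℕ∞) (σ j) Ω := fun j => (hσsmooth j).mono subset_closure
  have hσ1 : ∀ j, ContDiffOn ℝ 1 (σ j) Ω := fun j => (hσΩ j).of_le (by exact_mod_cast le_top)
  set K : Set (EV d) := {x ∈ Ω | u x = u x₀} with hK
  obtain ⟨F, hF, hKF⟩ : ∃ F, IsClosed F ∧ K = Ω ∩ F := by
    obtain ⟨F, hF, h⟩ := upperSemicontinuousOn_iff_preimage_Ici.1 husc (u x₀)
    refine ⟨F, hF, h ▸ ?_⟩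
    ext x
    exact ⟨fun hx => ⟨hx.1, hx.2.ge⟩, fun hx => ⟨hx.1, le_antisymm (hmax x hx.1) hx.2⟩⟩
  have ht : ∀ j, TangentTo K (σ j) := fun j =>
    tangentTo_contactSet hΩ hσ1 hGlsc hGprop hGscal hGell husc hsub hmax hnn j
  have hn : ∀ z ∈ K, ∀ p, ProximalNormal K z p → p = 0 := by
    intro z hz p hp
    have hspan : Submodule.span ℝ {v : EV d | ∃ W, LieGenerated σ W ∧ W z = v} ≤ (ℝ ∙ p)ᗮ := by
      refine Submodule.span_le.2 ?_
      rintro v ⟨W, hW, rfl⟩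
      rw [SetLike.mem_coe, Submodule.mem_orthogonal_singleton_iff_inner_left]
      exact hW.tangentTo hΩ hσΩ hF hKF ht z hz p hp
    rw [hhor z hz.1, top_le_iff] at hspan
    have hpp : p ∈ (ℝ ∙ p)ᗮ := hspan ▸ Submodule.mem_top
    rwa [Submodule.mem_orthogonal_singleton_iff_inner_left, inner_self_eq_zero] at hpp
  have hKopen : IsOpen K := isOpen_iff_mem_nhds.2 fun z hz =>
    mem_nhds_of_proximalNormal_eq_zero hΩ hF hKF hn hz
  have hcover : Ω ⊆ K ∪ Fᶜ := fun x hx => by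
    by_cases hxF : x ∈ F
    · exact Or.inl (hKF ▸ ⟨hx, hxF⟩)
    · exact Or.inr hxF
  have hsubK : Ω ⊆ K := by
    refine hconn.isPreconnected.subset_left_of_subset_union hKopen hF.isOpen_compl ?_ hcover
      ⟨x₀, hx₀, hx₀, rfl⟩
    exact disjoint_compl_right.mono_left (hKF ▸ inter_subset_right)
  exact fun x hx => (hsubK hx).2
end
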